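/- Let A be a finite abelian group with direct product decomposition A ≅ A₁ × ... × Aₙ into non-trivial cyclic groups of prime power order |Aᵢ| = aᵢ. Then the minimal faithful permutation degree of A equals a₁ + ... + aₙ. -/

import Mathlib

open Equiv Multiplicative Polynomial

/-- Minimal faithful permutation degree. -/
noncomputable def minDeg (G : Type*) [Group G] : ℕ :=
  sInf {n | ∃ f : G →* Equiv.Perm (Fin n), Function.Injective f}

/-- The `p`-torsion elements that are divisible by `p ^ r`. -/
def tors (G : Type*) [AddCommGroup G] (p r : ℕ) : Set G :=
  {x | p • x = 0 ∧ ∃ y, p ^ r • y = x}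

theorem tors_card_le {G H : Type*} [AddCommGroup G] [AddCommGroup H] [Finite H]
    (f : G →+ H) (hf : Function.Injective f) (p r : ℕ) :
    Nat.card (tors G p r) ≤ Nat.card (tors H p r) := by
  let g : tors G p r → tors H p r := fun x => ⟨f x.1, by
    obtain ⟨x, hx, y, rfl⟩ := x
    refine ⟨?_, f y, ?_⟩
    · rw [← map_nsmul, hx, map_zero]
    · simp⟩
  apply Nat.card_le_card_of_injective g
  intro x y hxy
  exact Subtype.ext (hf (congrArg Subtype.val hxy))

theorem tors_card_pi {ι : Type*} [Fintype ι] (G : ι → Type*) [∀ i, AddCommGroup (G i)]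
    (p r : ℕ) : Nat.card (tors (∀ i, G i) p r) = ∏ i, Nat.card (tors (G i) p r) := by
  rw [← Nat.card_pi]
  refine Nat.card_congr (Equiv.trans (Equiv.subtypeEquivRight ?_)
    (Equiv.subtypePiEquivPi (p := fun i x => x ∈ tors (G i) p r)))
  intro x
  constructor
  · rintro ⟨h, y, rfl⟩ i
    exact ⟨congrFun h i, y i, rfl⟩
  · intro h
    choose h1 y hy using h
    exact ⟨funext h1, y, funext hy⟩

theorem tors_card_zmod (q m p r : ℕ) (hq : q.Prime) (hp : p.Prime) :
    Nat.card (tors (ZMod (q ^ m)) p r) = p ^ (if q = p ∧ r < m then 1 else 0) := by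
  haveI : NeZero (q ^ m) := ⟨pow_ne_zero _ hq.ne_zero⟩
  split_ifs with h
  · obtain ⟨rfl, h⟩ := h
    rw [pow_one]
    apply le_antisymm
    · have := IsAddCyclic.card_nsmul_eq_zero_le (α := ZMod (q ^ m)) hq.pos
      refine le_trans ?_ this
      rw [← Fintype.card_subtype, ← Nat.card_eq_fintype_card]
      exact Nat.card_le_card_of_injective
        (fun x : tors (ZMod (q ^ m)) q r =>
          (⟨x.1, x.2.1⟩ : {a : ZMod (q ^ m) // q • a = 0}))
        (fun x y h => by
          simp only [Subtype.mk.injEq] at h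
          exact Subtype.ext h)
    · let g : Fin q → tors (ZMod (q ^ m)) q r := fun t => ⟨((t.1 * q ^ (m-1) : ℕ) : ZMod (q ^ m)), by
        refine ⟨?_, ((t.1 * q ^ (m-1-r) : ℕ) : ZMod (q ^ m)), ?_⟩
        · rw [nsmul_eq_mul, ← Nat.cast_mul, ZMod.natCast_eq_zero_iff]
          refine ⟨t.1, ?_⟩
          obtain ⟨m, rfl⟩ : ∃ m', m = m' + 1 := ⟨m-1, by omega⟩
          simp only [Nat.add_sub_cancel]; ring
        · rw [nsmul_eq_mul, ← Nat.cast_mul]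
          congr 1
          have : m - 1 = r + (m - 1 - r) := by omega
          conv_rhs => rw [this, pow_add]
          ring⟩
      have hg : Function.Injective g := by
        intro s t hst
        have h1 := congrArg Subtype.val hst
        have hlt : ∀ t : Fin q, t.1 * q ^ (m-1) < q ^ m := by
          intro t
          calc _ < q * q ^ (m-1) := Nat.mul_lt_mul_of_pos_right t.2 (pow_pos hq.pos _)
            _ = q ^ m := by rw [← pow_succ']; congr 1; omega
        have h2 := congrArg ZMod.val h1
        simp only [g] at h2
        rw [ZMod.val_natCast_of_lt (hlt s), ZMod.val_natCast_of_lt (hlt t)] at h2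
        exact Fin.ext (Nat.eq_of_mul_eq_mul_right (pow_pos hq.pos _) h2)
      simpa using Nat.card_le_card_of_injective g hg
  · rw [pow_zero, Nat.card_eq_one_iff_unique]
    have key : ∀ x ∈ tors (ZMod (q ^ m)) p r, x = 0 := by
      rintro x ⟨hx, y, rfl⟩
      by_cases hqp : q = p
      · subst hqp
        have hm : m ≤ r := by by_contra hh; exact h ⟨rfl, by omega⟩
        rw [nsmul_eq_mul, (ZMod.natCast_eq_zero_iff _ _).2 (pow_dvd_pow q hm), zero_mul]
      · have hu : IsUnit ((p : ℕ) : ZMod (q ^ m)) := by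
          rw [ZMod.isUnit_iff_coprime]
          exact Nat.Coprime.pow_right _ ((Nat.coprime_primes hp hq).2 (Ne.symm hqp))
        rw [nsmul_eq_mul] at hx
        exact (hu.mul_right_eq_zero).1 hx
    refine ⟨⟨fun x y => Subtype.ext ((key _ x.2).trans (key _ y.2).symm)⟩, ⟨⟨0, by simp, 0, by simp⟩⟩⟩

/-- Telescoping weight. -/
def wt (p r : ℕ) : ℕ := if r = 0 then p else p ^ (r+1) - p ^ r

theorem sum_wt (p m : ℕ) (hp : p.Prime) :
    ∑ r ∈ Finset.range m, wt p r = if m = 0 then 0 else p ^ m := by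
  induction m with
  | zero => simp
  | succ m ih =>
    rw [Finset.sum_range_succ, ih]
    by_cases h : m = 0
    · simp [h, wt]
    · have : p ^ m ≤ p ^ (m + 1) := Nat.pow_le_pow_right hp.pos (Nat.le_succ m)
      simp only [h, wt, if_false, Nat.succ_ne_zero]
      omega

theorem sum_as_count {ι : Type*} [Fintype ι] (P k : ι → ℕ) (hP : ∀ i, (P i).Prime) (M : ℕ)
    (hM : ∀ i, P i < M ∧ k i < M) :
    ∑ i, (if k i = 0 then 0 else P i ^ k i) =
      ∑ p ∈ Finset.range M, ∑ r ∈ Finset.range M,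
        (∑ i, if P i = p ∧ r < k i then 1 else 0) * wt p r := by
  simp_rw [Finset.sum_mul]
  have : ∀ p ∈ Finset.range M, ∑ r ∈ Finset.range M, ∑ i, (if P i = p ∧ r < k i then 1 else 0) * wt p r
     = ∑ i, ∑ r ∈ Finset.range M, (if P i = p ∧ r < k i then 1 else 0) * wt p r :=
    fun p _ => Finset.sum_comm
  rw [Finset.sum_congr rfl this, Finset.sum_comm]
  refine Finset.sum_congr rfl fun i _ => ?_
  rw [← sum_wt _ _ (hP i)]
  symm
  rw [Finset.sum_eq_single (P i)]
  · symm
    rw [← Finset.sum_subset (Finset.range_subset_range.2 (hM i).2.le) (f := fun r => (if P i = P i ∧ r < k i then 1 else 0) * wt (P i) r)]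
    · refine Finset.sum_congr rfl fun r hr => ?_
      simp [Finset.mem_range.1 hr]
    · intro r _ hr
      simp at hr
      simp [hr]
  · intro b _ hb
    simp [hb.symm]
  · intro h
    exact absurd (Finset.mem_range.2 (hM i).1) h

theorem sum_le_of_embed {ι κ : Type*} [Fintype ι] [Fintype κ] (P k : ι → ℕ) (Q m : κ → ℕ)
    (hP : ∀ i, (P i).Prime) (hQ : ∀ i, (Q i).Prime)
    (f : (∀ i, ZMod (P i ^ k i)) →+ (∀ i, ZMod (Q i ^ m i))) (hf : Function.Injective f) :
    ∑ i, (if k i = 0 then 0 else P i ^ k i) ≤ ∑ i, (if m i = 0 then 0 else Q i ^ m i) := by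
  haveI : ∀ i, NeZero (Q i ^ m i) := fun i => ⟨pow_ne_zero _ (hQ i).ne_zero⟩
  let M := ∑ i, P i + ∑ i, k i + ∑ i, Q i + ∑ i, m i + 1
  have h1 := fun i => Finset.single_le_sum (f := P) (fun i _ => Nat.zero_le _) (Finset.mem_univ i)
  have h2 := fun i => Finset.single_le_sum (f := k) (fun i _ => Nat.zero_le _) (Finset.mem_univ i)
  have h3 := fun i => Finset.single_le_sum (f := Q) (fun i _ => Nat.zero_le _) (Finset.mem_univ i)
  have h4 := fun i => Finset.single_le_sum (f := m) (fun i _ => Nat.zero_le _) (Finset.mem_univ i)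
  rw [sum_as_count P k hP M (fun i => by have := h1 i; have := h2 i; simp only [M]; omega),
    sum_as_count Q m hQ M (fun i => by have := h3 i; have := h4 i; simp only [M]; omega)]
  refine Finset.sum_le_sum fun p _ => Finset.sum_le_sum fun r _ => Nat.mul_le_mul_right _ ?_
  by_cases hp : p.Prime
  · have := tors_card_le f hf p r
    rw [tors_card_pi, tors_card_pi] at this
    simp_rw [tors_card_zmod _ _ p r (hP _) hp, tors_card_zmod _ _ p r (hQ _) hp] at this
    rw [Finset.prod_pow_eq_pow_sum, Finset.prod_pow_eq_pow_sum] at this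
    exact (Nat.pow_le_pow_iff_right hp.one_lt).1 this
  · have : ∀ i, ¬ (P i = p ∧ r < k i) := fun i h => hp (h.1 ▸ hP i)
    simp [this]

theorem sum_le_prod' {ι : Type*} (s : Finset ι) (Q m : ι → ℕ) (hQ : ∀ i, (Q i).Prime) :
    ∑ i ∈ s, (if m i = 0 then 0 else Q i ^ m i) ≤ ∏ i ∈ s, Q i ^ m i := by
  classical
  induction s using Finset.induction_on with
  | empty => simp
  | insert i s hi ih =>
    rw [Finset.sum_insert hi, Finset.prod_insert hi]
    have hpos : 0 < ∏ i ∈ s, Q i ^ m i := Finset.prod_pos fun i _ => pow_pos (hQ i).pos _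
    by_cases h : m i = 0
    · simpa [h] using ih
    · simp only [h, if_false]
      have h2 : 2 ≤ Q i ^ m i := (hQ i).two_le.trans (Nat.le_self_pow h _)
      by_cases h1 : ∏ i ∈ s, Q i ^ m i = 1
      · have : ∑ i ∈ s, (if m i = 0 then 0 else Q i ^ m i) = 0 := by
          refine Finset.sum_eq_zero fun j hj => ?_
          have := (Finset.prod_eq_one_iff.1 h1) j hj
          have h3 := (hQ j).one_lt
          by_contra hc
          have hm : m j ≠ 0 := by intro h0; simp [h0] at hc
          exact absurd this (Nat.one_lt_pow hm h3).ne'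
        rw [this, h1]; simp
      · have : 2 ≤ ∏ i ∈ s, Q i ^ m i := by omega
        nlinarith

theorem lower (A : Type) [CommGroup A] [Finite A] (n : ℕ) (P k : Fin n → ℕ)
    (hP : ∀ i, (P i).Prime) (hk : ∀ i, 1 ≤ k i)
    (e : A ≃* ∀ i, Multiplicative (ZMod (P i ^ k i))) (X : Type) [Fintype X]
    (f : A →* Equiv.Perm X) (hf : Function.Injective f) :
    ∑ i, P i ^ k i ≤ Fintype.card X := by
  classical
  letI : MulAction A X := MulAction.compHom X f
  have hsm : ∀ (a : A) (x : X), a • x = f a x := fun a x => rfl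
  let Ω := MulAction.orbitRel.Quotient A X
  let H : Ω → Subgroup A := fun ω => MulAction.stabilizer A ω.out
  have hcard : Fintype.card X = ∑ ω : Ω, Nat.card (A ⧸ H ω) := by
    rw [← Nat.card_eq_fintype_card,
      Nat.card_congr (MulAction.selfEquivSigmaOrbitsQuotientStabilizer A X), Nat.card_sigma]
  have hdec := fun ω : Ω => AddCommGroup.equiv_directSum_zmod_of_finite (Additive (A ⧸ H ω))
  choose ι hι Q hQ m g using hdec
  let g' : ∀ ω, Additive (A ⧸ H ω) ≃+ ∀ i, ZMod (Q ω i ^ m ω i) := fun ω =>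
    (Classical.choice (g ω)).trans (DirectSum.addEquivProd _)
  have hle : ∀ ω, ∑ i, (if m ω i = 0 then 0 else Q ω i ^ m ω i) ≤ Nat.card (A ⧸ H ω) := by
    intro ω
    refine (sum_le_prod' _ _ _ (hQ ω)).trans (le_of_eq ?_)
    have := Nat.card_congr (g' ω).toEquiv
    rw [Nat.card_pi] at this
    simp only [Nat.card_zmod] at this
    exact this.symm
  let E : (∀ i, ZMod (P i ^ k i)) →+ Additive A :=
    { toFun := fun x => Additive.ofMul (e.symm (fun i => ofAdd (x i)))
      map_zero' := by
        exact congrArg Additive.ofMul (map_one e.symm)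
      map_add' := fun x y => by
        exact congrArg Additive.ofMul
          (map_mul e.symm (fun i => ofAdd (x i)) (fun i => ofAdd (y i))) }
  have hE : Function.Injective E := by
    intro x y h
    exact e.symm.injective h
  let F : Additive A →+ (∀ l : (Σ ω, ι ω), ZMod (Q l.1 l.2 ^ m l.1 l.2)) :=
    { toFun := fun x l => g' l.1 (Additive.ofMul (QuotientGroup.mk' (H l.1) x.toMul)) l.2
      map_zero' := by
        funext l
        have : (Additive.ofMul (QuotientGroup.mk' (H l.1) (0 : Additive A).toMul)) = 0 := by simp
        simp only [this, map_zero, Pi.zero_apply]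
      map_add' := fun x y => by
        funext l
        simp only [toMul_add, map_mul, ofMul_mul, map_add, Pi.add_apply] }
  have hF : Function.Injective F := by
    rw [injective_iff_map_eq_zero]
    intro x hx
    have hmem : ∀ ω, x.toMul ∈ H ω := by
      intro ω
      have : g' ω (Additive.ofMul (QuotientGroup.mk' (H ω) x.toMul)) = 0 := by
        funext i
        exact congrFun hx ⟨ω, i⟩
      rw [map_eq_zero_iff _ (g' ω).injective] at this
      exact (QuotientGroup.eq_one_iff _).1 this
    have : x.toMul = 1 := by
      apply hf
      rw [map_one]
      ext y
      let ω : Ω := Quotient.mk'' y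
      have hy : (MulAction.orbitRel A X) ω.out y := Quotient.exact (Quotient.out_eq ω)
      obtain ⟨b, hb⟩ := MulAction.orbitRel_apply.1 ((MulAction.orbitRel A X).symm hy)
      have h1 : x.toMul • ω.out = ω.out := MulAction.mem_stabilizer_iff.1 (hmem ω)
      change x.toMul • y = y
      rw [← hb]
      change x.toMul • b • ω.out = b • ω.out
      rw [smul_smul, mul_comm, ← smul_smul, h1]
    exact this
  have := sum_le_of_embed P k (fun l : (Σ ω, ι ω) => Q l.1 l.2) (fun l => m l.1 l.2) hP
    (fun l => hQ l.1 l.2) (F.comp E) (hF.comp hE)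
  have h0 : ∀ i, k i ≠ 0 := fun i => by have := hk i; omega
  simp only [h0, if_false] at this
  refine this.trans ?_
  rw [hcard, Fintype.sum_sigma]
  exact Finset.sum_le_sum fun ω _ => hle ω

theorem stmt0 (A : Type) [CommGroup A] [Fintype A] (n : ℕ) (a P k : Fin n → ℕ)
    (hP : ∀ i, (P i).Prime) (hk : ∀ i, 1 ≤ k i) (ha : ∀ i, a i = P i ^ k i)
    (e : A ≃* ∀ i, Multiplicative (ZMod (a i))) :
    minDeg A = ∑ i, a i := by
  obtain rfl : a = fun i => P i ^ k i := funext ha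
  haveI : ∀ i, NeZero (P i ^ k i) := fun i => ⟨pow_ne_zero _ (hP i).ne_zero⟩
  apply le_antisymm
  · apply Nat.sInf_le
    let X := Σ i, ZMod (P i ^ k i)
    let f : A →* Equiv.Perm X :=
      { toFun := fun x => Equiv.sigmaCongrRight fun i => Equiv.addLeft (e x i).toAdd
        map_one' := by
          apply Equiv.ext
          rintro ⟨i, z⟩
          change (⟨i, (e 1 i).toAdd + z⟩ : X) = ⟨i, z⟩
          simp
        map_mul' := fun x y => by
          apply Equiv.ext
          rintro ⟨i, z⟩
          change (⟨i, (e (x * y) i).toAdd + z⟩ : X) = ⟨i, (e x i).toAdd + ((e y i).toAdd + z)⟩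
          simp [add_assoc] }
    have hf : Function.Injective f := by
      intro x y h
      apply e.injective
      funext i
      have := congrArg (fun s : Equiv.Perm X => s ⟨i, 0⟩) h
      change (⟨i, (e x i).toAdd + 0⟩ : X) = ⟨i, (e y i).toAdd + 0⟩ at this
      simpa using this
    have hX : Fintype.card X = ∑ i, P i ^ k i := by
      simp [X, ZMod.card]
    let E : X ≃ Fin (∑ i, P i ^ k i) := Fintype.equivFinOfCardEq hX
    exact ⟨(E.permCongrHom.toMonoidHom).comp f, E.permCongrHom.injective.comp hf⟩
  · refine le_csInf ?_ ?_
    · classical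
      exact ⟨Fintype.card A, ((Fintype.equivFin A).permCongrHom.toMonoidHom).comp
        (MulAction.toPermHom A A), (Fintype.equivFin A).permCongrHom.injective.comp
        MulAction.toPerm_injective⟩
    · rintro N ⟨f, hf⟩
      simpa using lower A n P k hP hk e (Fin N) f hf
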